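/- Let $v \in \mathbb{C}^{d_1}$ with $\|v\|_2 = 1$, let $d_2 < d_1$ with $d_2$ dividing $d_1$, and fix a block index $i$ with $1 \leq i \leq d_1/d_2$. Define $f(U) := \|\Pi_i U v\|_2 - \sqrt{d_2/d_1}$. Then for every positive integer $m$, under the Haar probability measure on $d_1 \times d_1$ unitary matrices, $\mathbb{E}_U\left[(f(U))^{2m}\right] \leq 4\left(\frac{2^4 m}{d_1}\right)^m$. -/

import Mathlib

open MeasureTheory Matrix

noncomputable section

/-- The Borel/product measurable structure on matrices over `ℂ`. -/
instance {d : ℕ} : MeasurableSpace (Matrix (Fin d) (Fin d) ℂ) :=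
  inferInstanceAs (MeasurableSpace (Fin d → Fin d → ℂ))

/-- The Euclidean (`ℓ₂`) norm of a vector in `ℂ^d`. -/
def l2norm {d : ℕ} (v : Fin d → ℂ) : ℝ := Real.sqrt (∑ a, ‖v a‖ ^ 2)

/-- The orthogonal projection of `ℂ^{d₁}` onto the (0-indexed) `i`-th consecutive block of
`d₂` coordinates. -/
def blockProj (d1 d2 i : ℕ) : Matrix (Fin d1) (Fin d1) ℂ :=
  Matrix.diagonal fun a => if a.val / d2 = i then 1 else 0


/-- Final one-dimensional estimate from the Stein identity. -/
theorem final_est (ρ : Measure ℝ) [IsProbabilityMeasure ρ] (k n m : ℕ) (hk : 0 < k) (hn : 0 < n)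
    (hm : 0 < m)
    (hsupp : ∀ᵐ x ∂ρ, 0 ≤ x ∧ x ≤ 1)
    (hIntegr : ∀ f : ℝ → ℝ, Continuous f → Integrable f ρ)
    (stein : ∀ g g' : ℝ → ℝ, (∀ x, HasDerivAt g (g' x) x) → Continuous g' →
      ∫ x, ((k - n * x) * g x + x * (1 - x) * g' x) ∂ρ = 0) :
    ∫ x, (Real.sqrt x - Real.sqrt ((k : ℝ) / n)) ^ (2 * m) ∂ρ ≤ 4 * (2 ^ 4 * (m : ℝ) / n) ^ m := by
  have hk' : (0 : ℝ) < k := by exact_mod_cast hk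
  have hn' : (0 : ℝ) < n := by exact_mod_cast hn
  have hm' : (1 : ℝ) ≤ m := by exact_mod_cast hm
  set p : ℝ := (k : ℝ) / n with hp
  have hp0 : 0 < p := by positivity
  have hpn : n * p = k := by rw [hp]; field_simp
  have hQ : 0 ≤ 2 ^ 4 * (m : ℝ) / n := by positivity
  by_cases hc : (k : ℝ) ≤ 15 * m
  · have hmom : ∀ j : ℕ, j ≤ m → ∫ x, x ^ j ∂ρ ≤ (2 ^ 4 * (m : ℝ) / n) ^ j := by
      intro j
      induction j with
      | zero => intro _; simp
      | succ j ih =>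
        intro hj
        have ih := ih (by omega)
        have hj' : (j : ℝ) + 1 ≤ m := by exact_mod_cast hj
        have h := stein (fun x => x ^ j) (fun x => j * x ^ (j - 1))
          (fun x => by simpa using hasDerivAt_pow j x) (by fun_prop)
        have hpt : ∫ x, ((k - n * x) * x ^ j + x * (1 - x) * (j * x ^ (j - 1))) ∂ρ
            = ∫ x, ((k + j) * x ^ j - (n + j) * x ^ (j + 1)) ∂ρ := by
          congr 1; ext x
          rcases j with _ | j
          · simp
          · simp only [Nat.add_sub_cancel]; push_cast; ring
        have h2 : ∫ x, ((k + j) * x ^ j - (n + j) * x ^ (j + 1)) ∂ρ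
            = (k + j) * ∫ x, x ^ j ∂ρ - (n + j) * ∫ x, x ^ (j + 1) ∂ρ := by
          rw [integral_sub (hIntegr _ (by fun_prop)) (hIntegr _ (by fun_prop)),
            integral_const_mul, integral_const_mul]
        have h0 : 0 ≤ ∫ x, x ^ (j + 1) ∂ρ :=
          integral_nonneg_of_ae (by filter_upwards [hsupp] with x hx; exact pow_nonneg hx.1 _)
        have h00 : 0 ≤ ∫ x, x ^ j ∂ρ :=
          integral_nonneg_of_ae (by filter_upwards [hsupp] with x hx; exact pow_nonneg hx.1 _)
        have h3 : n * ∫ x, x ^ (j + 1) ∂ρ ≤ 2 ^ 4 * m * ∫ x, x ^ j ∂ρ := by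
          have : (j : ℝ) * ∫ x, x ^ (j + 1) ∂ρ ≥ 0 := by positivity
          have : (k + j : ℝ) * ∫ x, x ^ j ∂ρ ≤ 2 ^ 4 * m * ∫ x, x ^ j ∂ρ := by
            apply mul_le_mul_of_nonneg_right _ h00
            linarith
          linarith
        calc ∫ x, x ^ (j + 1) ∂ρ ≤ (2 ^ 4 * m / n) * ∫ x, x ^ j ∂ρ := by
              rw [div_mul_eq_mul_div, le_div_iff₀ hn']; linarith
          _ ≤ (2 ^ 4 * m / n) * (2 ^ 4 * (m : ℝ) / n) ^ j := by gcongr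
          _ = _ := by ring
    have hpm : p ^ m ≤ (2 ^ 4 * (m : ℝ) / n) ^ m := by
      rw [hp]
      gcongr
      linarith
    calc ∫ x, (Real.sqrt x - Real.sqrt p) ^ (2 * m) ∂ρ ≤ ∫ x, (x ^ m + p ^ m) ∂ρ := by
          apply integral_mono_ae (hIntegr _ (by fun_prop)) (hIntegr _ (by fun_prop))
          filter_upwards [hsupp] with x hx
          rw [pow_mul]
          have hsx := Real.sq_sqrt hx.1
          have hsp := Real.sq_sqrt hp0.le
          have hx0 := Real.sqrt_nonneg x
          have hp00 := Real.sqrt_nonneg p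
          rcases le_total x p with h | h
          · have := Real.sqrt_le_sqrt h
            have : (Real.sqrt x - Real.sqrt p) ^ 2 ≤ p := by nlinarith
            have := pow_le_pow_left₀ (sq_nonneg _) this m
            have := pow_nonneg hx.1 m
            linarith
          · have := Real.sqrt_le_sqrt h
            have : (Real.sqrt x - Real.sqrt p) ^ 2 ≤ x := by nlinarith
            have := pow_le_pow_left₀ (sq_nonneg _) this m
            have := pow_nonneg hp0.le m
            linarith
      _ = ∫ x, x ^ m ∂ρ + p ^ m := by
          rw [integral_add (hIntegr _ (by fun_prop)) (hIntegr _ (by fun_prop))]; simp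
      _ ≤ _ := by
          have := hmom m le_rfl
          have := pow_nonneg hQ m
          linarith
  · push Not at hc
    have hmom : ∀ j : ℕ, j ≤ m → ∫ x, (x - p) ^ (2 * j) ∂ρ ≤ (2 ^ 4 * (m : ℝ) / n * p) ^ j := by
      intro j
      induction j with
      | zero => intro _; simp
      | succ j ih =>
        intro hj
        have ih := ih (by omega)
        have hj' : (j : ℝ) + 1 ≤ m := by exact_mod_cast hj
        have h := stein (fun x => (x - p) ^ (2 * j + 1)) (fun x => (2 * j + 1 : ℕ) * (x - p) ^ (2 * j))
          (fun x => by simpa using ((hasDerivAt_id x).sub_const p).fun_pow (2 * j + 1)) (by fun_prop)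
        have hle : ∫ x, (n / 2 * (x - p) ^ (2 * (j + 1)) - 8 * m * p * (x - p) ^ (2 * j)) ∂ρ ≤
            ∫ x, (-((k - n * x) * (x - p) ^ (2 * j + 1) +
              x * (1 - x) * ((2 * j + 1 : ℕ) * (x - p) ^ (2 * j)))) ∂ρ := by
          apply integral_mono_ae (hIntegr _ (by fun_prop)) (hIntegr _ (by fun_prop))
          filter_upwards [hsupp] with x hx
          have e : -((k - n * x) * (x - p) ^ (2 * j + 1) +
              x * (1 - x) * ((2 * j + 1 : ℕ) * (x - p) ^ (2 * j))) =
              (n * (x - p) ^ 2 - (2 * j + 1) * (x * (1 - x))) * (x - p) ^ (2 * j) := by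
            rw [← hpn]; push_cast; ring
          have e2 : n / 2 * (x - p) ^ (2 * (j + 1)) - 8 * m * p * (x - p) ^ (2 * j) =
              (n / 2 * (x - p) ^ 2 - 8 * m * p) * (x - p) ^ (2 * j) := by ring
          rw [e, e2]
          apply mul_le_mul_of_nonneg_right _ (by rw [pow_mul]; positivity)
          have h1 : (2 * j + 1) * (x * (1 - x)) ≤ 2 * m * x := by
            have : x * (1 - x) ≤ x := by nlinarith [hx.1]
            calc (2 * j + 1) * (x * (1 - x)) ≤ (2 * j + 1) * x := by gcongr
              _ ≤ 2 * m * x := by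
                apply mul_le_mul_of_nonneg_right _ hx.1
                linarith
          have h2 : 4 * p * x ≤ 8 * p ^ 2 + (x - p) ^ 2 := by
            nlinarith [sq_nonneg (x - p - 2 * p)]
          have h3 : 2 * m * x * p ≤ 8 * m * p * p + n / 2 * (x - p) ^ 2 * p := by
            have : (m : ℝ) * (x - p) ^ 2 ≤ n * p * (x - p) ^ 2 := by
              apply mul_le_mul_of_nonneg_right _ (sq_nonneg _)
              linarith
            have : (m : ℝ) * (4 * p * x) ≤ m * (8 * p ^ 2 + (x - p) ^ 2) := by gcongr
            nlinarith [sq_nonneg p]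
          have h4 : 2 * m * x ≤ 8 * m * p + n / 2 * (x - p) ^ 2 := by
            apply le_of_mul_le_mul_right _ hp0
            linarith
          linarith
        rw [integral_neg, h, integral_sub (hIntegr _ (by fun_prop)) (hIntegr _ (by fun_prop)),
            integral_const_mul, integral_const_mul] at hle
        calc ∫ x, (x - p) ^ (2 * (j + 1)) ∂ρ ≤ (2 ^ 4 * m / n * p) * ∫ x, (x - p) ^ (2 * j) ∂ρ := by
              rw [div_mul_eq_mul_div, div_mul_eq_mul_div, le_div_iff₀ hn']; linarith
          _ ≤ (2 ^ 4 * m / n * p) * (2 ^ 4 * (m : ℝ) / n * p) ^ j := by gcongr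
          _ = _ := by ring
    calc ∫ x, (Real.sqrt x - Real.sqrt p) ^ (2 * m) ∂ρ ≤ ∫ x, ((x - p) ^ (2 * m) / p ^ m) ∂ρ := by
          apply integral_mono_ae (hIntegr _ (by fun_prop)) (hIntegr _ (by fun_prop))
          filter_upwards [hsupp] with x hx
          rw [pow_mul, pow_mul, ← div_pow]
          apply pow_le_pow_left₀ (sq_nonneg _)
          rw [le_div_iff₀ hp0]
          have hsx := Real.sq_sqrt hx.1
          have hsp := Real.sq_sqrt hp0.le
          have hx0 := Real.sqrt_nonneg x
          have hp00 := Real.sqrt_nonneg p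
          calc (√x - √p) ^ 2 * p = (√x - √p) ^ 2 * (√p) ^ 2 := by rw [hsp]
            _ ≤ (√x - √p) ^ 2 * (√x + √p) ^ 2 := by gcongr; linarith
            _ = (√x ^ 2 - √p ^ 2) ^ 2 := by ring
            _ = (x - p) ^ 2 := by rw [hsx, hsp]
      _ = (∫ x, (x - p) ^ (2 * m) ∂ρ) / p ^ m := by rw [integral_div]
      _ ≤ (2 ^ 4 * (m : ℝ) / n * p) ^ m / p ^ m := by
          gcongr; exact hmom m le_rfl
      _ = (2 ^ 4 * (m : ℝ) / n) ^ m := by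
          rw [mul_pow]; field_simp
      _ ≤ _ := by
          have := pow_nonneg hQ m
          linarith

/-- Complex rotation in the `(a,b)` coordinate plane. -/
def rotL {n : ℕ} (a b : Fin n) (c : ℂ) (t : ℝ) : (Fin n → ℂ) →ₗ[ℂ] (Fin n → ℂ) where
  toFun w := fun j => if j = a then (Real.cos t : ℂ) * w a + c * (Real.sin t : ℂ) * w b
    else if j = b then (Real.cos t : ℂ) * w b - (star c) * (Real.sin t : ℂ) * w a
    else w j
  map_add' x y := by
    ext j; simp only [Pi.add_apply]; split_ifs <;> ring
  map_smul' r x := by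
    ext j; simp only [Pi.smul_apply, smul_eq_mul, RingHom.id_apply]; split_ifs <;> ring

theorem rotL_apply {n : ℕ} (a b : Fin n) (c : ℂ) (t : ℝ) (w : Fin n → ℂ) (j : Fin n) :
    rotL a b c t w j = if j = a then (Real.cos t : ℂ) * w a + c * (Real.sin t : ℂ) * w b
    else if j = b then (Real.cos t : ℂ) * w b - (star c) * (Real.sin t : ℂ) * w a
    else w j := rfl

theorem rotL_inv {n : ℕ} (a b : Fin n) (hab : a ≠ b) (c : ℂ) (hc : star c * c = 1) (t : ℝ) :
    (rotL a b c (-t)).comp (rotL a b c t) = LinearMap.id := by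
  have hcs : (Real.cos t : ℂ) ^ 2 + (Real.sin t : ℂ) ^ 2 = 1 := by
    exact_mod_cast Real.cos_sq_add_sin_sq t
  ext1 k
  refine LinearMap.ext fun x => ?_
  ext j
  simp only [LinearMap.comp_apply, LinearMap.id_apply, rotL_apply, Real.cos_neg, Real.sin_neg,
    if_true, hab.symm, if_false, Complex.ofReal_neg]
  generalize (LinearMap.single ℂ (fun _ : Fin n => ℂ) k) x = w
  split_ifs with h1 h2
  · subst h1
    linear_combination w j * hcs + w j * (Real.sin t : ℂ) ^ 2 * hc
  · subst h2
    linear_combination w j * hcs + w j * (Real.sin t : ℂ) ^ 2 * hc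
  · rfl

theorem rot_unitary {n : ℕ} (a b : Fin n) (hab : a ≠ b) (c : ℂ) (hc : star c * c = 1) (t : ℝ) :
    ∃ V : Matrix.unitaryGroup (Fin n) ℂ, ∀ w, (V : Matrix (Fin n) (Fin n) ℂ).mulVec w
      = rotL a b c t w := by
  refine ⟨⟨LinearMap.toMatrix' (rotL a b c t), ?_⟩, fun w => ?_⟩
  · rw [Matrix.mem_unitaryGroup_iff']
    have : star (LinearMap.toMatrix' (rotL a b c t)) = LinearMap.toMatrix' (rotL a b c (-t)) := by
      ext j k
      simp only [Matrix.star_apply, LinearMap.toMatrix'_apply, rotL_apply, Real.cos_neg,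
        Real.sin_neg]
      generalize Real.cos t = C
      generalize Real.sin t = D
      clear hc
      by_cases h1 : j = a <;> by_cases h2 : j = b <;> by_cases h3 : k = a <;>
        by_cases h4 : k = b <;>
        simp_all [Pi.single_apply, apply_ite, eq_comm (a := k) (b := j)]
    rw [this, ← LinearMap.toMatrix'_comp, rotL_inv a b hab c hc, LinearMap.toMatrix'_id]
  · simp [LinearMap.toMatrix'_mulVec]

theorem rot_deriv {n : ℕ} (a b : Fin n) (hab : a ≠ b) (c : ℂ) (hc : star c * c = 1) (t : ℝ)
    (w : Fin n → ℂ) (j : Fin n) :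
    HasDerivAt (fun s : ℝ => rotL a b c s w j) (if j = a then c * rotL a b c t w b else
      if j = b then - star c * rotL a b c t w a else 0) t := by
  have hC : HasDerivAt (fun s : ℝ => (Real.cos s : ℂ)) (-(Real.sin t : ℂ)) t := by
    simpa using (Real.hasDerivAt_cos t).ofReal_comp
  have hS : HasDerivAt (fun s : ℝ => (Real.sin s : ℂ)) (Real.cos t : ℂ) t := by
    simpa using (Real.hasDerivAt_sin t).ofReal_comp
  simp only [rotL_apply, if_true, hab.symm, if_false]
  split_ifs with h1 h2
  · refine ((hC.mul_const (w a)).add ((hS.const_mul c).mul_const (w b))).congr_deriv ?_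
    linear_combination ((Real.sin t : ℂ) * w a) * hc
  · refine ((hC.mul_const (w b)).sub ((hS.const_mul (star c)).mul_const (w a))).congr_deriv ?_
    linear_combination ((Real.sin t : ℂ) * w b) * hc
  · exact hasDerivAt_const _ _

theorem rot_bound {n : ℕ} (a b : Fin n) (c : ℂ) (hc : ‖c‖ = 1) (t : ℝ)
    (w : Fin n → ℂ) (hw : ‖w‖ ≤ 1) : ‖rotL a b c t w‖ ≤ 2 := by
  rw [pi_norm_le_iff_of_nonneg (by norm_num)]
  intro j
  have h := fun j => (norm_le_pi_norm w j).trans hw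
  have h1 : ‖(Real.cos t : ℂ)‖ ≤ 1 := by
    rw [Complex.norm_real]; exact Real.abs_cos_le_one t
  have h2 : ‖(Real.sin t : ℂ)‖ ≤ 1 := by
    rw [Complex.norm_real]; exact Real.abs_sin_le_one t
  have key : ∀ x y : ℂ, ‖x‖ ≤ 1 → ‖y‖ ≤ 1 → ‖x * y‖ ≤ 1 := fun x y hx hy => by
    rw [norm_mul]; exact mul_le_one₀ hx (norm_nonneg _) hy
  rw [rotL_apply]
  split_ifs
  · refine (norm_add_le _ _).trans ?_
    have := key _ _ h1 (h a)
    have := key _ _ (key _ _ hc.le h2) (h b)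
    linarith
  · refine (norm_sub_le _ _).trans ?_
    have := key _ _ h1 (h b)
    have := key _ _ (key _ _ ((norm_star c).trans hc).le h2) (h a)
    linarith
  · linarith [h j]

/-- Infinitesimal invariance. -/
theorem int_deriv_zero {n : ℕ} (ν : Measure (Fin n → ℂ)) [IsProbabilityMeasure ν]
    (hinv : ∀ V : Matrix.unitaryGroup (Fin n) ℂ,
      ν.map (fun w => (V : Matrix (Fin n) (Fin n) ℂ).mulVec w) = ν)
    (hsupp : ∀ᵐ w ∂ν, ‖w‖ ≤ 1)
    (hIntegr : ∀ f : (Fin n → ℂ) → ℝ, Continuous f → Integrable f ν)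
    (a b : Fin n) (hab : a ≠ b) (c : ℂ) (hc : ‖c‖ = 1)
    (F G : (Fin n → ℂ) → ℝ) (hF : Continuous F) (hG : Continuous G)
    (hd : ∀ w t, HasDerivAt (fun s => F (rotL a b c s w)) (G (rotL a b c t w)) t) :
    ∫ w, G w ∂ν = 0 := by
  have hc' : star c * c = 1 := by
    have := Complex.conj_mul' c
    simp [this, hc]
  have hcont : ∀ t, Continuous (rotL a b c t) := fun t => LinearMap.continuous_of_finiteDimensional _
  have hmap : ∀ t, ν.map (fun w => rotL a b c t w) = ν := by
    intro t
    obtain ⟨V, hV⟩ := rot_unitary a b hab c hc' t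
    have := hinv V
    simpa only [hV] using this
  have hconst : ∀ (H : (Fin n → ℂ) → ℝ), Continuous H → ∀ t,
      ∫ w, H (rotL a b c t w) ∂ν = ∫ w, H w ∂ν := by
    intro H hH t
    conv_rhs => rw [← hmap t]
    rw [integral_map (hcont t).measurable.aemeasurable hH.aestronglyMeasurable]
  obtain ⟨C, hC⟩ := (isCompact_closedBall (0 : Fin n → ℂ) 2).exists_bound_of_continuousOn
    hG.continuousOn
  have key := hasDerivAt_integral_of_dominated_loc_of_deriv_le (μ := ν)
    (F := fun s w => F (rotL a b c s w)) (F' := fun s w => G (rotL a b c s w)) (x₀ := (0:ℝ))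
    (s := Set.univ) (bound := fun _ => C) Filter.univ_mem
    (Filter.Eventually.of_forall fun t => (hF.comp (hcont t)).aestronglyMeasurable)
    (hIntegr _ (hF.comp (hcont 0))) (hG.comp (hcont 0)).aestronglyMeasurable
    (by
      filter_upwards [hsupp] with w hw t _
      exact hC _ (by simpa using rot_bound a b c hc t w hw))
    (integrable_const C)
    (Filter.Eventually.of_forall fun w t _ => hd w t)
  have h1 := key.2
  simp only [hconst F hF, hconst G hG] at h1
  exact h1.unique (hasDerivAt_const _ _)

/-- The Stein pair identity. -/
theorem pair_c {n : ℕ} (ν : Measure (Fin n → ℂ)) [IsProbabilityMeasure ν]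
    (hinv : ∀ V : Matrix.unitaryGroup (Fin n) ℂ,
      ν.map (fun w => (V : Matrix (Fin n) (Fin n) ℂ).mulVec w) = ν)
    (hsupp : ∀ᵐ w ∂ν, ‖w‖ ≤ 1)
    (hIntegr : ∀ f : (Fin n → ℂ) → ℝ, Continuous f → Integrable f ν)
    (S : Finset (Fin n))
    (a b : Fin n) (ha : a ∈ S) (hb : b ∉ S) (c : ℂ) (hc : ‖c‖ = 1)
    (g g' : ℝ → ℝ) (hg : ∀ x, HasDerivAt g (g' x) x) (hg' : Continuous g') :
    ∫ w, ((‖w b‖ ^ 2 - ‖w a‖ ^ 2) * g (∑ s ∈ S, ‖w s‖ ^ 2) +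
      2 * (inner ℝ (c * w b) (w a)) ^ 2 * g' (∑ s ∈ S, ‖w s‖ ^ 2)) ∂ν = 0 := by
  have hab : a ≠ b := fun h => hb (h ▸ ha)
  have hc' : star c * c = 1 := by
    have := Complex.conj_mul' c
    simp [this, hc]
  have hgc : Continuous g := continuous_iff_continuousAt.2 fun x => (hg x).continuousAt
  refine int_deriv_zero ν hinv hsupp hIntegr a b hab c hc
    (fun w => (inner ℝ (c * w b) (w a)) * g (∑ s ∈ S, ‖w s‖ ^ 2)) _
    (by fun_prop) (by fun_prop) ?_
  intro w t
  have hD := fun j => rot_deriv a b hab c hc' t w j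
  have hA := hD a
  have hB := hD b
  simp only [if_true, hab.symm, if_false] at hA hB
  have hX : HasDerivAt (fun s => ∑ j ∈ S, ‖rotL a b c s w j‖ ^ 2)
      (2 * inner ℝ (c * rotL a b c t w b) (rotL a b c t w a)) t := by
    have := HasDerivAt.fun_sum (u := S) (fun j _ => (hD j).norm_sq)
    refine this.congr_deriv ?_
    rw [Finset.sum_eq_single_of_mem a ha]
    · simp [real_inner_comm]
    · intro j hj hja
      have : j ≠ b := fun h => hb (h ▸ hj)
      simp [hja, this]
  have hI := (hB.const_mul c).inner ℝ hA
  have := hI.mul ((hg _).comp t hX)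
  refine this.congr_deriv ?_
  simp only [Function.comp_apply]
  generalize rotL a b c t w a = x
  generalize rotL a b c t w b = y
  have e1 : inner ℝ (c * y) (c * y) = ‖y‖ ^ 2 := by
    rw [real_inner_self_eq_norm_sq, norm_mul, hc, one_mul]
  have e2 : inner ℝ (c * (-star c * x)) x = - ‖x‖ ^ 2 := by
    have : c * (-star c * x) = - x := by linear_combination (-x) * hc'
    rw [this, inner_neg_left, real_inner_self_eq_norm_sq]
  rw [e1, e2]
  ring

theorem pair_id {n : ℕ} (ν : Measure (Fin n → ℂ)) [IsProbabilityMeasure ν]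
    (hinv : ∀ V : Matrix.unitaryGroup (Fin n) ℂ,
      ν.map (fun w => (V : Matrix (Fin n) (Fin n) ℂ).mulVec w) = ν)
    (hsupp : ∀ᵐ w ∂ν, ‖w‖ ≤ 1)
    (hIntegr : ∀ f : (Fin n → ℂ) → ℝ, Continuous f → Integrable f ν)
    (S : Finset (Fin n))
    (a b : Fin n) (ha : a ∈ S) (hb : b ∉ S)
    (g g' : ℝ → ℝ) (hg : ∀ x, HasDerivAt g (g' x) x) (hg' : Continuous g') :
    ∫ w, ((‖w b‖ ^ 2 - ‖w a‖ ^ 2) * g (∑ s ∈ S, ‖w s‖ ^ 2) +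
      ‖w a‖ ^ 2 * ‖w b‖ ^ 2 * g' (∑ s ∈ S, ‖w s‖ ^ 2)) ∂ν = 0 := by
  have hgc : Continuous g := continuous_iff_continuousAt.2 fun x => (hg x).continuousAt
  have h1 := pair_c ν hinv hsupp hIntegr S a b ha hb 1 (by simp) g g' hg hg'
  have h2 := pair_c ν hinv hsupp hIntegr S a b ha hb Complex.I (by simp) g g' hg hg'
  have h3 := integral_add (μ := ν) (hIntegr (fun w => (‖w b‖ ^ 2 - ‖w a‖ ^ 2) * g (∑ s ∈ S, ‖w s‖ ^ 2) +
      2 * (inner ℝ (1 * w b) (w a)) ^ 2 * g' (∑ s ∈ S, ‖w s‖ ^ 2)) (by fun_prop))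
      (hIntegr (fun w => (‖w b‖ ^ 2 - ‖w a‖ ^ 2) * g (∑ s ∈ S, ‖w s‖ ^ 2) +
      2 * (inner ℝ (Complex.I * w b) (w a)) ^ 2 * g' (∑ s ∈ S, ‖w s‖ ^ 2)) (by fun_prop))
  rw [h1, h2] at h3
  have h4 : ∀ x y : ℂ, (inner ℝ (1 * y) x) ^ 2 + (inner ℝ (Complex.I * y) x) ^ 2 
      = ‖x‖ ^ 2 * ‖y‖ ^ 2 := by
    intro x y
    rw [← Complex.normSq_eq_norm_sq, ← Complex.normSq_eq_norm_sq]
    simp [Complex.inner, Complex.normSq_apply]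
    ring
  have h5 : ∀ w : Fin n → ℂ, ((‖w b‖ ^ 2 - ‖w a‖ ^ 2) * g (∑ s ∈ S, ‖w s‖ ^ 2) +
      2 * (inner ℝ (1 * w b) (w a)) ^ 2 * g' (∑ s ∈ S, ‖w s‖ ^ 2)) +
      ((‖w b‖ ^ 2 - ‖w a‖ ^ 2) * g (∑ s ∈ S, ‖w s‖ ^ 2) +
      2 * (inner ℝ (Complex.I * w b) (w a)) ^ 2 * g' (∑ s ∈ S, ‖w s‖ ^ 2)) =
      2 * ((‖w b‖ ^ 2 - ‖w a‖ ^ 2) * g (∑ s ∈ S, ‖w s‖ ^ 2) +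
      ‖w a‖ ^ 2 * ‖w b‖ ^ 2 * g' (∑ s ∈ S, ‖w s‖ ^ 2)) := by
    intro w
    rw [← h4]; ring
  simp only [h5] at h3
  rw [integral_const_mul] at h3
  linarith

theorem stein_sphere {n : ℕ} (ν : Measure (Fin n → ℂ)) [IsProbabilityMeasure ν]
    (hinv : ∀ V : Matrix.unitaryGroup (Fin n) ℂ,
      ν.map (fun w => (V : Matrix (Fin n) (Fin n) ℂ).mulVec w) = ν)
    (hsupp : ∀ᵐ w ∂ν, ‖w‖ ≤ 1)
    (hsph : ∀ᵐ w ∂ν, ∑ j, ‖w j‖ ^ 2 = 1)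
    (hIntegr : ∀ f : (Fin n → ℂ) → ℝ, Continuous f → Integrable f ν)
    (S : Finset (Fin n))
    (g g' : ℝ → ℝ) (hg : ∀ x, HasDerivAt g (g' x) x) (hg' : Continuous g') :
    ∫ w, ((S.card - n * (∑ s ∈ S, ‖w s‖ ^ 2)) * g (∑ s ∈ S, ‖w s‖ ^ 2) +
      (∑ s ∈ S, ‖w s‖ ^ 2) * (1 - ∑ s ∈ S, ‖w s‖ ^ 2) * g' (∑ s ∈ S, ‖w s‖ ^ 2)) ∂ν = 0 := by
  have hgc : Continuous g := continuous_iff_continuousAt.2 fun x => (hg x).continuousAt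
  have h : ∑ a ∈ S, ∑ b ∈ Sᶜ, ∫ w, ((‖w b‖ ^ 2 - ‖w a‖ ^ 2) * g (∑ s ∈ S, ‖w s‖ ^ 2) +
      ‖w a‖ ^ 2 * ‖w b‖ ^ 2 * g' (∑ s ∈ S, ‖w s‖ ^ 2)) ∂ν = 0 :=
    Finset.sum_eq_zero fun a ha => Finset.sum_eq_zero fun b hb =>
      pair_id ν hinv hsupp hIntegr S a b ha (Finset.mem_compl.1 hb) g g' hg hg'
  have hs : ∀ a ∈ S, ∑ b ∈ Sᶜ, ∫ w, ((‖w b‖ ^ 2 - ‖w a‖ ^ 2) * g (∑ s ∈ S, ‖w s‖ ^ 2) +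
      ‖w a‖ ^ 2 * ‖w b‖ ^ 2 * g' (∑ s ∈ S, ‖w s‖ ^ 2)) ∂ν =
      ∫ w, ∑ b ∈ Sᶜ, ((‖w b‖ ^ 2 - ‖w a‖ ^ 2) * g (∑ s ∈ S, ‖w s‖ ^ 2) +
      ‖w a‖ ^ 2 * ‖w b‖ ^ 2 * g' (∑ s ∈ S, ‖w s‖ ^ 2)) ∂ν := fun a _ =>
    (integral_finsetSum _ fun b _ => hIntegr _ (by fun_prop)).symm
  rw [Finset.sum_congr rfl hs, ← integral_finsetSum _ fun a _ => hIntegr _ (by fun_prop)] at h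
  rw [← h]
  apply integral_congr_ae
  filter_upwards [hsph] with w hw
  have hcompl : ∑ b ∈ Sᶜ, ‖w b‖ ^ 2 = 1 - ∑ s ∈ S, ‖w s‖ ^ 2 := by
    rw [← hw, ← Finset.sum_add_sum_compl S]; ring
  have hcard : ((Sᶜ).card : ℝ) = n - S.card := by
    have := Finset.card_add_card_compl S
    rw [Fintype.card_fin] at this
    have : (S.card : ℝ) + (Sᶜ).card = n := by exact_mod_cast this
    linarith
  generalize hx : g (∑ s ∈ S, ‖w s‖ ^ 2) = G
  generalize hx' : g' (∑ s ∈ S, ‖w s‖ ^ 2) = G'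
  simp only [Finset.sum_add_distrib, ← Finset.sum_mul, ← Finset.mul_sum, Finset.sum_sub_distrib,
    Finset.sum_const, nsmul_eq_mul, hcompl, hcard]
  ring

theorem block_card (d1 d2 i : ℕ) (hi : i < d1 / d2) :
    (Finset.univ.filter fun a : Fin d1 => a.val / d2 = i).card = d2 := by
  have hd2 : 0 < d2 := by
    rcases Nat.eq_zero_or_pos d2 with h | h
    · subst h; simp at hi
    · exact h
  have hle : (i + 1) * d2 ≤ d1 :=
    (Nat.mul_le_mul_right d2 hi).trans (Nat.div_mul_le_self d1 d2)
  have : ((Finset.univ.filter fun a : Fin d1 => a.val / d2 = i).map Fin.valEmbedding)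
      = Finset.Ico (i * d2) ((i + 1) * d2) := by
    ext x
    simp only [Finset.mem_map, Finset.mem_filter, Finset.mem_univ, true_and, Finset.mem_Ico,
      Fin.valEmbedding_apply]
    constructor
    · rintro ⟨a, ha, rfl⟩
      rw [Nat.div_eq_iff hd2] at ha
      rw [Nat.add_mul]; omega
    · rintro ⟨h1, h2⟩
      refine ⟨⟨x, by omega⟩, ?_, rfl⟩
      rw [Nat.div_eq_iff hd2]
      rw [Nat.add_mul] at h2
      simp only; omega
  rw [← Finset.card_map Fin.valEmbedding, this, Nat.card_Ico, Nat.add_mul]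
  omega

theorem unitary_sphere {d : ℕ} (U : Matrix.unitaryGroup (Fin d) ℂ) (v : Fin d → ℂ) :
    ∑ a, ‖((U : Matrix (Fin d) (Fin d) ℂ).mulVec v) a‖ ^ 2 = ∑ a, ‖v a‖ ^ 2 := by
  have key : ∀ w : Fin d → ℂ, ((∑ a, ‖w a‖ ^ 2 : ℝ) : ℂ) = star w ⬝ᵥ w := by
    intro w
    simp only [dotProduct, Pi.star_apply, Complex.ofReal_sum, Complex.ofReal_pow]
    refine Finset.sum_congr rfl fun a _ => ?_
    exact (Complex.conj_mul' (w a)).symm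
  have h : ((∑ a, ‖((U : Matrix (Fin d) (Fin d) ℂ).mulVec v) a‖ ^ 2 : ℝ) : ℂ)
      = ((∑ a, ‖v a‖ ^ 2 : ℝ) : ℂ) := by
    rw [key, key, Matrix.star_mulVec, Matrix.dotProduct_mulVec, Matrix.vecMul_vecMul,
      ← Matrix.star_eq_conjTranspose, Matrix.mem_unitaryGroup_iff'.1 U.2, Matrix.vecMul_one]
  exact_mod_cast h

theorem measurable_orbit {d : ℕ} (v : Fin d → ℂ) :
    Measurable (fun U : Matrix.unitaryGroup (Fin d) ℂ =>
      (U : Matrix (Fin d) (Fin d) ℂ).mulVec v) := by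
  have he : ∀ j k, Measurable (fun U : Matrix.unitaryGroup (Fin d) ℂ =>
      (U : Matrix (Fin d) (Fin d) ℂ) j k) := fun j k =>
    (measurable_pi_apply k).comp ((measurable_pi_apply j).comp
      (measurable_subtype_coe (α := Matrix (Fin d) (Fin d) ℂ)))
  refine measurable_pi_iff.2 fun j => ?_
  simp only [Matrix.mulVec, dotProduct]
  exact Finset.measurable_sum _ fun k _ => (he j k).mul_const _

/-- **Haar moment bound for `f(U) = ‖Π_i U v‖₂ − √(d₂/d₁)`:** for every positive integer
`m`, `𝔼_U[(f(U))^{2m}] ≤ 4 (2⁴ m / d₁)^m` under the Haar probability measure (here: any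
left-translation-invariant probability measure on the unitary group). -/
theorem haar_moment_bound_f
    (d1 d2 : ℕ) (hd : d2 < d1) (hdvd : d2 ∣ d1)
    (v : Fin d1 → ℂ) (hv : l2norm v = 1)
    (i : ℕ) (hi : i < d1 / d2)
    (μ : Measure (Matrix.unitaryGroup (Fin d1) ℂ)) [IsProbabilityMeasure μ]
    (hinv : ∀ V : Matrix.unitaryGroup (Fin d1) ℂ, μ.map (fun U => V * U) = μ)
    (m : ℕ) (hm : 0 < m) :
    (∫ U : Matrix.unitaryGroup (Fin d1) ℂ,
        (l2norm ((blockProj d1 d2 i).mulVec ((U : Matrix (Fin d1) (Fin d1) ℂ).mulVec v)) -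
          Real.sqrt ((d2 : ℝ) / d1)) ^ (2 * m) ∂μ)
      ≤ 4 * (2 ^ 4 * (m : ℝ) / d1) ^ m := by
  have hd2 : 0 < d2 := by
    rcases Nat.eq_zero_or_pos d2 with h | h
    · subst h; simp at hi
    · exact h
  have hmeas := measurable_orbit v
  have hv2 : ∑ a, ‖v a‖ ^ 2 = 1 := by
    unfold l2norm at hv
    rwa [Real.sqrt_eq_one] at hv
  set ν : Measure (Fin d1 → ℂ) :=
    μ.map (fun U : Matrix.unitaryGroup (Fin d1) ℂ =>
      (U : Matrix (Fin d1) (Fin d1) ℂ).mulVec v) with hν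
  have : IsProbabilityMeasure ν := Measure.isProbabilityMeasure_map hmeas.aemeasurable
  have hνinv : ∀ V : Matrix.unitaryGroup (Fin d1) ℂ,
      ν.map (fun w => (V : Matrix (Fin d1) (Fin d1) ℂ).mulVec w) = ν := by
    intro V
    have hVc : Continuous (fun w : Fin d1 → ℂ => (V : Matrix (Fin d1) (Fin d1) ℂ).mulVec w) := by
      fun_prop
    have hVae : AEMeasurable (fun U : Matrix.unitaryGroup (Fin d1) ℂ => V * U) μ := by
      by_contra hne
      have h0 := hinv V
      rw [Measure.map_of_not_aemeasurable hne] at h0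
      exact IsProbabilityMeasure.ne_zero μ h0.symm
    rw [hν, Measure.map_map hVc.measurable hmeas]
    conv_rhs => rw [← hinv V]
    rw [AEMeasurable.map_map_of_aemeasurable hmeas.aemeasurable hVae]
    congr 1
    ext U
    simp [Function.comp, Matrix.mulVec_mulVec]
  have hsph : ∀ᵐ w ∂ν, ∑ j, ‖w j‖ ^ 2 = 1 := by
    rw [hν, ae_map_iff hmeas.aemeasurable]
    · exact Filter.Eventually.of_forall fun U => (unitary_sphere U v).trans hv2
    · exact (isClosed_eq (by fun_prop) continuous_const).measurableSet
  have hsupp : ∀ᵐ w ∂ν, ‖w‖ ≤ 1 := by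
    filter_upwards [hsph] with w hw
    rw [pi_norm_le_iff_of_nonneg zero_le_one]
    intro j
    have : ‖w j‖ ^ 2 ≤ ∑ j, ‖w j‖ ^ 2 :=
      Finset.single_le_sum (f := fun j => ‖w j‖ ^ 2) (fun _ _ => sq_nonneg _) (Finset.mem_univ j)
    rw [hw] at this
    exact (sq_le_one_iff₀ (norm_nonneg _)).1 this
  have hIntegr : ∀ f : (Fin d1 → ℂ) → ℝ, Continuous f → Integrable f ν := by
    intro f hf
    obtain ⟨C, hC⟩ := (isCompact_closedBall (0 : Fin d1 → ℂ) 1).exists_bound_of_continuousOn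
      hf.continuousOn
    refine Integrable.of_bound hf.aestronglyMeasurable C ?_
    filter_upwards [hsupp] with w hw
    exact hC w (by simpa using hw)
  set S : Finset (Fin d1) := Finset.univ.filter fun a : Fin d1 => a.val / d2 = i with hS
  have hcard : S.card = d2 := block_card d1 d2 i hi
  have hXc : Continuous (fun w : Fin d1 → ℂ => ∑ s ∈ S, ‖w s‖ ^ 2) := by fun_prop
  have hXm := hXc.measurable.aemeasurable (μ := ν)
  set ρ : Measure ℝ := ν.map (fun w => ∑ s ∈ S, ‖w s‖ ^ 2) with hρ
  have : IsProbabilityMeasure ρ := Measure.isProbabilityMeasure_map hXm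
  have hfin := final_est ρ d2 d1 m hd2 (by omega) hm
    (by
      rw [hρ, ae_map_iff hXm measurableSet_Icc]
      filter_upwards [hsph] with w hw
      refine ⟨by positivity, ?_⟩
      rw [← hw]
      exact Finset.sum_le_sum_of_subset_of_nonneg (Finset.subset_univ _)
        fun _ _ _ => sq_nonneg _)
    (fun f hf => by
      rw [hρ, integrable_map_measure hf.aestronglyMeasurable hXm]
      exact hIntegr _ (hf.comp hXc))
    (fun g g' hg hg' => by
      have hgc : Continuous g := continuous_iff_continuousAt.2 fun x => (hg x).continuousAt
      rw [hρ, integral_map hXm (Continuous.aestronglyMeasurable (by fun_prop))]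
      have := stein_sphere ν hνinv hsupp hsph hIntegr S g g' hg hg'
      rwa [hcard] at this)
  rw [hρ, integral_map hXm (Continuous.aestronglyMeasurable (by fun_prop)), hν,
    integral_map hmeas.aemeasurable (Continuous.aestronglyMeasurable (by fun_prop))] at hfin
  convert hfin using 6 with U
  simp only [l2norm, blockProj, Matrix.mulVec_diagonal]
  congr 1
  rw [hS, Finset.sum_filter]
  refine Finset.sum_congr rfl fun a _ => ?_
  split_ifs <;> simp
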